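/- For every uniform instance of the asymmetric binary matrix partition problem, there exists a partition scheme B attaining the maximum partition value and satisfying all of the following properties: (P1) B fully covers A^+, i.e., for every column j ∈ A^+ there is a row i with A_{ij}=1 such that {j} is a bundle of B_i; (P2) for each row i, all columns j with A_{ij}=1 such that {j} is not a bundle of B_i are contained in a single common bundle of B_i; (P3) for each column j ∈ A^0, there is at most one row i such that the bundle of B_i containing j is mixed; (P4) for each row i, the columns of A^0 that are not contained in the mixed bundle of B_i (if any) form a single bundle of B_i consisting entirely of columns of A^0. -/

import Mathlib

open Finset

structure PartitionScheme (n m : ℕ) where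
  bundle : Fin n → Fin m → Finset (Fin m)
  mem_bundle : ∀ i j, j ∈ bundle i j
  consistent : ∀ i j j', j' ∈ bundle i j → bundle i j' = bundle i j

noncomputable def smoothValue {n m : ℕ} (A : Fin n → Fin m → ℝ) (p : Fin m → ℝ)
    (B : PartitionScheme n m) (i : Fin n) (j : Fin m) : ℝ :=
  (∑ ℓ ∈ B.bundle i j, p ℓ * A i ℓ) / ∑ ℓ ∈ B.bundle i j, p ℓ

noncomputable def partitionValue {n m : ℕ} (A : Fin n → Fin m → ℝ) (p : Fin m → ℝ)
    (B : PartitionScheme n m) : ℝ :=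
  ∑ j, p j * ⨆ i, smoothValue A p B i j

/-- A bundle `b` is mixed in row `i` if it contains both a 1-entry and a 0-entry of row `i`. -/
def MixedBundle {n m : ℕ} (A : Fin n → Fin m → ℝ) (i : Fin n) (b : Finset (Fin m)) : Prop :=
  (∃ j ∈ b, A i j = 1) ∧ (∃ j ∈ b, A i j = 0)

/-- `B` fully covers the set of one-columns. -/
def FullyCovers {n m : ℕ} (A : Fin n → Fin m → ℝ) (B : PartitionScheme n m) : Prop :=
  ∀ j : Fin m, (∃ i, A i j = 1) → ∃ i, A i j = 1 ∧ B.bundle i j = {j}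

open scoped Classical in
noncomputable def mixedOneAppearances {n m : ℕ} (A : Fin n → Fin m → ℝ)
    (B : PartitionScheme n m) : ℕ :=
  ∑ i, ∑ b ∈ (Finset.univ.image (B.bundle i)).filter (MixedBundle A i),
    (b.filter (fun j => A i j = 1)).card

/-- Half the harmonic mean of two nonnegative numbers. -/
noncomputable def parallelSum (x y : ℝ) : ℝ := x * y / (x + y)

theorem parallelSum_le {x y : ℝ} (hx : 0 ≤ x) (hy : 0 ≤ y) (t : ℝ) :
    parallelSum x y ≤ t ^ 2 * x + (1 - t) ^ 2 * y := by
  unfold parallelSum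
  rcases (add_nonneg hx hy).eq_or_lt with h | h
  · rw [← h, div_zero]; positivity
  · rw [div_le_iff₀ h]
    nlinarith [sq_nonneg (t * x - (1 - t) * y)]

theorem exists_parallelSum_eq {x y : ℝ} (hx : 0 ≤ x) (hy : 0 ≤ y) :
    ∃ t : ℝ, 0 ≤ t ∧ t ≤ 1 ∧ parallelSum x y = t ^ 2 * x + (1 - t) ^ 2 * y := by
  rcases (add_nonneg hx hy).eq_or_lt with h | h
  · have hx0 : x = 0 := by linarith
    have hy0 : y = 0 := by linarith
    exact ⟨0, le_rfl, zero_le_one, by simp [parallelSum, hx0, hy0]⟩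
  · refine ⟨y / (x + y), by positivity, (div_le_one h).2 (by linarith), ?_⟩
    unfold parallelSum
    field_simp
    ring

theorem parallelSum_le_one_add_sub_one_sub_one {x y : ℝ} (hx : 1 ≤ x) (hy : 1 ≤ y) :
    parallelSum x y ≤ 1 + parallelSum (x - 1) (y - 1) := by
  obtain ⟨t, h0, h1, h⟩ := exists_parallelSum_eq (sub_nonneg.2 hx) (sub_nonneg.2 hy)
  have := parallelSum_le (zero_le_one.trans hx) (zero_le_one.trans hy) t
  rw [h]
  nlinarith

theorem parallelSum_le_one_add_sub_one {x y : ℝ} (hx : 1 ≤ x) (hy : 0 ≤ y) :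
    parallelSum x y ≤ 1 + parallelSum (x - 1) y := by
  obtain ⟨t, h0, h1, h⟩ := exists_parallelSum_eq (sub_nonneg.2 hx) hy
  have := parallelSum_le (zero_le_one.trans hx) hy t
  rw [h]
  nlinarith

section Assignment

variable {n m : ℕ} (A : Fin n → Fin m → ℝ) (f : Fin m → Fin n) (i : Fin n)

/-- The number of one-entries of row `i` whose column is assigned to row `i`. -/
noncomputable def assignedOnes : ℝ := ∑ j, if f j = i then A i j else 0

/-- The number of zero-entries of row `i` whose column is assigned to row `i`. -/
noncomputable def assignedZeros : ℝ := ∑ j, if f j = i then 1 - A i j else 0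

/-- The number of one-entries of row `i` whose column is assigned to another row. -/
noncomputable def unassignedOnes : ℝ := ∑ j, if f j = i then 0 else A i j

/-- The largest total smooth value that row `i` can give to the columns assigned to it. -/
noncomputable def rowValue : ℝ :=
  assignedOnes A f i + parallelSum (assignedZeros A f i) (unassignedOnes A f i)

variable {A}

theorem entry_nonneg (hA : ∀ i j, A i j = 0 ∨ A i j = 1) (i : Fin n) (j : Fin m) : 0 ≤ A i j := by
  rcases hA i j with h | h <;> simp [h]

theorem entry_le_one (hA : ∀ i j, A i j = 0 ∨ A i j = 1) (i : Fin n) (j : Fin m) : A i j ≤ 1 := by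
  rcases hA i j with h | h <;> simp [h]

theorem assignedZeros_nonneg (hA : ∀ i j, A i j = 0 ∨ A i j = 1) : 0 ≤ assignedZeros A f i := by
  refine sum_nonneg fun j _ => ?_
  split_ifs
  exacts [sub_nonneg.2 (entry_le_one hA i j), le_rfl]

theorem unassignedOnes_nonneg (hA : ∀ i j, A i j = 0 ∨ A i j = 1) : 0 ≤ unassignedOnes A f i := by
  refine sum_nonneg fun j _ => ?_
  split_ifs
  exacts [le_rfl, entry_nonneg hA i j]

theorem one_le_assignedZeros (hA : ∀ i j, A i j = 0 ∨ A i j = 1) {f : Fin m → Fin n} {i : Fin n}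
    {j : Fin m} (hj : f j = i) (h0 : A i j = 0) : 1 ≤ assignedZeros A f i := by
  have := single_le_sum (f := fun j => if f j = i then 1 - A i j else 0) (s := univ)
    (fun j _ => by
      split_ifs
      exacts [sub_nonneg.2 (entry_le_one hA i j), le_rfl]) (mem_univ j)
  simpa [hj, h0, assignedZeros] using this

theorem one_le_unassignedOnes (hA : ∀ i j, A i j = 0 ∨ A i j = 1) {f : Fin m → Fin n} {i : Fin n}
    {j : Fin m} (hj : f j ≠ i) (h1 : A i j = 1) : 1 ≤ unassignedOnes A f i := by
  have := single_le_sum (f := fun j => if f j = i then 0 else A i j) (s := univ)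
    (fun j _ => by
      split_ifs
      exacts [le_rfl, entry_nonneg hA i j]) (mem_univ j)
  simpa [hj, h1, unassignedOnes] using this

theorem assignedZeros_eq_zero (hA : ∀ i j, A i j = 0 ∨ A i j = 1) {f : Fin m → Fin n} {i : Fin n}
    (h : ∀ j, f j = i → A i j ≠ 0) : assignedZeros A f i = 0 := by
  refine sum_eq_zero fun j _ => ?_
  split_ifs with hj
  · rw [(hA i j).resolve_left (h j hj), sub_self]
  · rfl

theorem sum_apply_update {α β : Type*} [Fintype α] [DecidableEq α] (T : α → β → ℝ) (f : α → β)
    (a : α) (b : β) :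
    ∑ x, T x (Function.update f a b x) = ∑ x, T x (f x) - T a (f a) + T a b := by
  rw [← add_sum_erase _ _ (mem_univ a), ← add_sum_erase _ (fun x => T x (f x)) (mem_univ a),
    sum_congr rfl fun x hx => by rw [Function.update_of_ne (ne_of_mem_erase hx)]]
  simp
  ring

theorem assignedOnes_update (j : Fin m) (k : Fin n) :
    assignedOnes A (Function.update f j k) i =
      assignedOnes A f i - (if f j = i then A i j else 0) + if k = i then A i j else 0 :=
  sum_apply_update (fun j k => if k = i then A i j else 0) f j k

theorem assignedZeros_update (j : Fin m) (k : Fin n) :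
    assignedZeros A (Function.update f j k) i =
      assignedZeros A f i - (if f j = i then 1 - A i j else 0) + if k = i then 1 - A i j else 0 :=
  sum_apply_update (fun j k => if k = i then 1 - A i j else 0) f j k

theorem unassignedOnes_update (j : Fin m) (k : Fin n) :
    unassignedOnes A (Function.update f j k) i =
      unassignedOnes A f i - (if f j = i then 0 else A i j) + if k = i then 0 else A i j :=
  sum_apply_update (fun j k => if k = i then 0 else A i j) f j k

theorem exists_more_ones_of_badly_assigned (hA : ∀ i j, A i j = 0 ∨ A i j = 1)
    {f : Fin m → Fin n} {j : Fin m} {k : Fin n} (hk : A k j = 1) (hj : A (f j) j = 0) :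
    ∃ g : Fin m → Fin n, ∑ i, rowValue A f i ≤ ∑ i, rowValue A g i ∧
      (∀ x, A (f x) x = 1 → A (g x) x = 1) ∧ A (g j) j = 1 := by
  have hne : f j ≠ k := by rintro rfl; simp [hj] at hk
  by_cases hc : ∃ c, f c = k ∧ A k c = 0
  · obtain ⟨c, hck, hc0⟩ := hc
    have hcj : c ≠ j := by rintro rfl; exact hne hck
    refine ⟨Function.update (Function.update f j k) c (f j), sum_le_sum fun i _ => ?_, ?_, ?_⟩
    · simp only [rowValue, assignedOnes_update, assignedZeros_update, unassignedOnes_update,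
        Function.update_of_ne hcj, hck]
      by_cases hik : k = i
      · subst hik
        have := parallelSum_le_one_add_sub_one_sub_one (one_le_assignedZeros hA hck hc0)
          (one_le_unassignedOnes hA hne hk)
        simp [hne, hk, hc0]
        linarith
      by_cases hij : f j = i
      · subst hij
        rcases hA (f j) c with h | h
        · simp [hik, hj, h]
        · have := parallelSum_le_one_add_sub_one_sub_one (one_le_assignedZeros hA rfl hj)
            (one_le_unassignedOnes hA (hck.trans_ne hik) h)
          simp [hik, hj, h]
          linarith
      · simp [hik, hij]
    · intro x hx
      have hxc : x ≠ c := by rintro rfl; rw [hck, hc0] at hx; exact zero_ne_one hx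
      have hxj : x ≠ j := by rintro rfl; rw [hj] at hx; exact zero_ne_one hx
      rwa [Function.update_of_ne hxc, Function.update_of_ne hxj]
    · rwa [Function.update_of_ne hcj.symm, Function.update_self]
  · push Not at hc
    refine ⟨Function.update f j k, ?_, ?_, by rwa [Function.update_self]⟩
    · have key : ∀ i, rowValue A f i + (if k = i then 1 else 0) ≤
          rowValue A (Function.update f j k) i + if f j = i then 1 else 0 := by
        intro i
        simp only [rowValue, assignedOnes_update, assignedZeros_update, unassignedOnes_update]
        by_cases hik : k = i
        · subst hik
          simp [hne, hk, assignedZeros_eq_zero hA hc, parallelSum]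
        by_cases hij : f j = i
        · subst hij
          have := parallelSum_le_one_add_sub_one (one_le_assignedZeros hA rfl hj)
            (unassignedOnes_nonneg f (f j) hA)
          simp [hik, hj]
          linarith
        · simp [hik, hij]
      have := sum_le_sum fun i (_ : i ∈ univ) => key i
      simpa [sum_add_distrib] using this
    · intro x hx
      have hxj : x ≠ j := by rintro rfl; rw [hj] at hx; exact zero_ne_one hx
      rwa [Function.update_of_ne hxj]

theorem exists_covering_assignment (hA : ∀ i j, A i j = 0 ∨ A i j = 1) (f : Fin m → Fin n) :
    ∃ g : Fin m → Fin n, ∑ i, rowValue A f i ≤ ∑ i, rowValue A g i ∧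
      ∀ j, (∃ i, A i j = 1) → A (g j) j = 1 := by
  classical
  obtain ⟨g, hg, hmax⟩ := exists_max_image
    ({g | ∑ i, rowValue A f i ≤ ∑ i, rowValue A g i} : Finset (Fin m → Fin n))
    (fun g => #{j | A (g j) j = 1}) ⟨f, by simp⟩
  simp only [mem_filter, mem_univ, true_and] at hg hmax
  refine ⟨g, hg, fun j ⟨k, hk⟩ => ?_⟩
  by_contra hj
  obtain ⟨g', hle, hmono, hg'⟩ :=
    exists_more_ones_of_badly_assigned hA hk ((hA _ _).resolve_right hj)
  refine (hmax g' (hg.trans hle)).not_gt (card_lt_card (ssubset_iff_of_subset ?_ |>.2 ⟨j, ?_, ?_⟩))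
  · intro x
    simpa using hmono x
  · simpa using hg'
  · simpa using hj

end Assignment

section UpperBound

variable {n m : ℕ} {A : Fin n → Fin m → ℝ}

theorem sum_bundle_le (hA : ∀ i j, A i j = 0 ∨ A i j = 1) (f : Fin m → Fin n) (i : Fin n)
    (b : Finset (Fin m)) (t : ℝ) :
    ∑ j ∈ b, (if f j = i then (∑ ℓ ∈ b, A i ℓ) / #b else 0) ≤
      ∑ j ∈ b, ((if f j = i then A i j else 0) + t ^ 2 * (if f j = i then 1 - A i j else 0) +
        (1 - t) ^ 2 * if f j = i then 0 else A i j) := by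
  set p := ∑ j ∈ b, if f j = i then A i j else 0 with hp
  set s := ∑ j ∈ b, if f j = i then 1 - A i j else 0 with hs
  set q := ∑ j ∈ b, if f j = i then 0 else A i j with hq
  have hp0 : 0 ≤ p := sum_nonneg fun j _ => by
    split_ifs
    exacts [entry_nonneg hA i j, le_rfl]
  have hs0 : 0 ≤ s := sum_nonneg fun j _ => by
    split_ifs
    exacts [sub_nonneg.2 (entry_le_one hA i j), le_rfl]
  have hq0 : 0 ≤ q := sum_nonneg fun j _ => by
    split_ifs
    exacts [le_rfl, entry_nonneg hA i j]
  have hones : ∑ ℓ ∈ b, A i ℓ = p + q := by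
    rw [hp, hq, ← sum_add_distrib]
    exact sum_congr rfl fun j _ => by split_ifs <;> simp
  have hcount : ∑ j ∈ b, (if f j = i then (1 : ℝ) else 0) = p + s := by
    rw [hp, hs, ← sum_add_distrib]
    exact sum_congr rfl fun j _ => by split_ifs <;> simp
  have hcard : p + s + q ≤ #b := by
    rw [hp, hs, hq, ← sum_add_distrib, ← sum_add_distrib, card_eq_sum_ones, Nat.cast_sum]
    refine sum_le_sum fun j _ => ?_
    have := entry_le_one hA i j
    split_ifs <;> simp [this]
  have hleft : ∑ j ∈ b, (if f j = i then (∑ ℓ ∈ b, A i ℓ) / #b else 0) =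
      (p + s) * ((p + q) / #b) := by
    rw [← hcount, sum_mul, hones]
    exact sum_congr rfl fun j _ => by split_ifs <;> simp
  rw [hleft, sum_add_distrib, sum_add_distrib, ← mul_sum, ← mul_sum, ← hp, ← hs, ← hq]
  rcases (Nat.cast_nonneg (α := ℝ) #b).eq_or_lt with h | h
  · rw [← h, div_zero, mul_zero]
    positivity
  · rw [← mul_div_assoc, div_le_iff₀ h]
    have hw : 0 ≤ p + t ^ 2 * s + (1 - t) ^ 2 * q := by positivity
    refine le_trans ?_ (mul_le_mul_of_nonneg_left hcard hw)
    have h1 : 0 ≤ p * (t ^ 2 * s + (1 - t) ^ 2 * q) := by positivity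
    nlinarith [sq_nonneg (t * s - (1 - t) * q)]

theorem PartitionScheme.filter_bundle_eq (B : PartitionScheme n m) (i : Fin n) (j : Fin m) :
    ({ℓ | B.bundle i ℓ = B.bundle i j} : Finset (Fin m)) = B.bundle i j := by
  ext ℓ
  simp only [mem_filter, mem_univ, true_and]
  exact ⟨fun h => h ▸ B.mem_bundle i ℓ, B.consistent i j ℓ⟩

theorem smoothValue_uniform {p : Fin m → ℝ} (hm : 0 < m) (hp : ∀ j, p j = 1 / m)
    (B : PartitionScheme n m) (i : Fin n) (j : Fin m) :
    smoothValue A p B i j = (∑ ℓ ∈ B.bundle i j, A i ℓ) / #(B.bundle i j) := by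
  have hm' : (m : ℝ) ≠ 0 := by positivity
  simp only [smoothValue, hp, ← mul_sum, sum_const, nsmul_eq_mul]
  rw [mul_comm (#(B.bundle i j) : ℝ), mul_div_mul_left _ _ (one_div_ne_zero hm')]

theorem sum_smoothValue_le_rowValue {p : Fin m → ℝ} (hm : 0 < m) (hp : ∀ j, p j = 1 / m)
    (hA : ∀ i j, A i j = 0 ∨ A i j = 1) (B : PartitionScheme n m) (f : Fin m → Fin n)
    (i : Fin n) :
    ∑ j, (if f j = i then smoothValue A p B i j else 0) ≤ rowValue A f i := by
  obtain ⟨t, -, -, ht⟩ := exists_parallelSum_eq (assignedZeros_nonneg f i hA)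
    (unassignedOnes_nonneg f i hA)
  have hrow : rowValue A f i = ∑ j, ((if f j = i then A i j else 0) +
      t ^ 2 * (if f j = i then 1 - A i j else 0) + (1 - t) ^ 2 * if f j = i then 0 else A i j) := by
    rw [rowValue, ht, sum_add_distrib, sum_add_distrib, ← mul_sum, ← mul_sum, assignedOnes,
      assignedZeros, unassignedOnes, add_assoc]
  rw [hrow, ← sum_fiberwise univ (B.bundle i), ← sum_fiberwise univ (B.bundle i)]
  refine sum_le_sum fun b _ => ?_
  by_cases hb : ∃ j, B.bundle i j = b
  · obtain ⟨j₀, rfl⟩ := hb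
    rw [B.filter_bundle_eq]
    refine le_trans (sum_congr rfl fun j hj => ?_).le (sum_bundle_le hA f i (B.bundle i j₀) t)
    rw [smoothValue_uniform hm hp, B.consistent i j₀ j hj]
  · push Not at hb
    simp [filter_false_of_mem fun j _ => hb j]

theorem partitionValue_uniform {p : Fin m → ℝ} (hp : ∀ j, p j = 1 / m)
    (B : PartitionScheme n m) :
    partitionValue A p B = 1 / m * ∑ j, ⨆ i, smoothValue A p B i j := by
  simp [partitionValue, hp, mul_sum]

theorem exists_partitionValue_le (hn : 0 < n) (hm : 0 < m) {p : Fin m → ℝ}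
    (hp : ∀ j, p j = 1 / m) (hA : ∀ i j, A i j = 0 ∨ A i j = 1) (B : PartitionScheme n m) :
    ∃ f : Fin m → Fin n, partitionValue A p B ≤ 1 / m * ∑ i, rowValue A f i := by
  have : Nonempty (Fin n) := ⟨⟨0, hn⟩⟩
  choose f hf using fun j => exists_eq_ciSup_of_finite (f := fun i => smoothValue A p B i j)
  refine ⟨f, ?_⟩
  rw [partitionValue_uniform hp]
  gcongr
  calc ∑ j, ⨆ i, smoothValue A p B i j
      = ∑ j, ∑ i, if f j = i then smoothValue A p B i j else 0 :=
        sum_congr rfl fun j _ => by simp [← hf j]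
    _ = ∑ i, ∑ j, if f j = i then smoothValue A p B i j else 0 := sum_comm
    _ ≤ _ := sum_le_sum fun i _ => sum_smoothValue_le_rowValue hm hp hA B f i

end UpperBound

section Construction

variable {n m : ℕ}

/-- The scheme whose bundles in row `i` are the fibres of `key i`. -/
def PartitionScheme.ofKey {κ : Type*} [DecidableEq κ] (key : Fin n → Fin m → κ) :
    PartitionScheme n m where
  bundle i j := {ℓ | key i ℓ = key i j}
  mem_bundle i j := by simp
  consistent i j j' h := by
    ext ℓ
    simp_all

theorem PartitionScheme.mem_ofKey {κ : Type*} [DecidableEq κ] {key : Fin n → Fin m → κ}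
    {i : Fin n} {j ℓ : Fin m} : ℓ ∈ (ofKey key).bundle i j ↔ key i ℓ = key i j := by
  simp [ofKey]

open scoped Classical in
/-- The label of the bundle of column `j` in row `i` in the structured scheme of the assignment
`g`: `inl j` is a singleton, `inr true` the mixed bundle and `inr false` the bundle of remaining
zero-columns. -/
noncomputable def structuredKey (A : Fin n → Fin m → ℝ) (g : Fin m → Fin n) (i : Fin n)
    (j : Fin m) : Fin m ⊕ Bool :=
  if A i j = 1 then if g j = i then .inl j else .inr true
  else if ∃ k, A k j = 1 then .inl j
  else if g j = i ∧ ∃ ℓ, g ℓ ≠ i ∧ A i ℓ = 1 then .inr true else .inr false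

/-- The structured scheme of the assignment `g`. -/
noncomputable def structuredScheme (A : Fin n → Fin m → ℝ) (g : Fin m → Fin n) :
    PartitionScheme n m :=
  .ofKey (structuredKey A g)

variable {A : Fin n → Fin m → ℝ} {g : Fin m → Fin n} {i : Fin n} {j ℓ : Fin m}

theorem mem_structuredScheme :
    ℓ ∈ (structuredScheme A g).bundle i j ↔ structuredKey A g i ℓ = structuredKey A g i j :=
  PartitionScheme.mem_ofKey

theorem structuredScheme_bundle_eq (h : structuredKey A g i ℓ = structuredKey A g i j) :
    (structuredScheme A g).bundle i ℓ = (structuredScheme A g).bundle i j :=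
  (structuredScheme A g).consistent i j ℓ (mem_structuredScheme.2 h)

theorem structuredScheme_bundle_eq_singleton (hj : g j = i) (h : A i j = 1) :
    (structuredScheme A g).bundle i j = {j} := by
  ext ℓ
  rw [mem_structuredScheme, mem_singleton]
  constructor
  · intro hℓ
    simp only [structuredKey, h, hj] at hℓ
    split_ifs at hℓ <;> simp_all
  · rintro rfl; rfl

theorem structuredKey_of_unassigned_one (hj : g j ≠ i) (h : A i j = 1) :
    structuredKey A g i j = .inr true := by
  simp [structuredKey, h, hj]

theorem structuredKey_of_zero_column (hz : ∀ k, A k j = 0) :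
    (g j = i ∧ (∃ ℓ, g ℓ ≠ i ∧ A i ℓ = 1) ∧ structuredKey A g i j = .inr true) ∨
      structuredKey A g i j = .inr false := by
  simp only [structuredKey, hz]
  split_ifs <;> simp_all

theorem structuredKey_eq_false (h : structuredKey A g i j = .inr false) (k : Fin n) :
    A k j ≠ 1 := by
  simp only [structuredKey] at h
  split_ifs at h <;> simp_all

theorem mixedBundle_structuredScheme_iff (hz : ∀ k, A k j = 0) :
    MixedBundle A i ((structuredScheme A g).bundle i j) ↔
      structuredKey A g i j = .inr true := by
  rcases structuredKey_of_zero_column (g := g) (i := i) hz with ⟨-, ⟨ℓ, hℓ, hℓ1⟩, h⟩ | h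
  · refine ⟨fun _ => h, fun _ => ⟨⟨ℓ, mem_structuredScheme.2 ?_, hℓ1⟩, j,
      mem_structuredScheme.2 rfl, hz i⟩⟩
    rw [h, structuredKey_of_unassigned_one hℓ hℓ1]
  · refine ⟨fun ⟨⟨ℓ, hℓ, hℓ1⟩, _⟩ => ?_, fun h' => by simp [h] at h'⟩
    rw [mem_structuredScheme, h] at hℓ
    exact absurd hℓ1 (structuredKey_eq_false hℓ i)

theorem structuredKey_eq_true_iff (hA : ∀ i j, A i j = 0 ∨ A i j = 1)
    (hg : ∀ j, (∃ i, A i j = 1) → A (g j) j = 1) (hex : ∃ ℓ, g ℓ ≠ i ∧ A i ℓ = 1) :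
    structuredKey A g i j = .inr true ↔ (g j = i ↔ A i j = 0) := by
  have hg' := hg j
  rcases hA i j with h | h
  · by_cases hj : g j = i
    · subst hj
      have hz : ¬ ∃ k, A k j = 1 := fun hk => by simp [h] at hg'; exact hk.elim hg'
      simp only [structuredKey, h, hz, hex]
      simp
    · simp only [structuredKey, h, hj]
      split_ifs <;> simp_all
  · by_cases hj : g j = i <;> simp [structuredKey, h, hj]

theorem smoothValue_structuredScheme_of_zero {p : Fin m → ℝ} (hm : 0 < m)
    (hp : ∀ j, p j = 1 / m) (hA : ∀ i j, A i j = 0 ∨ A i j = 1)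
    (hg : ∀ j, (∃ i, A i j = 1) → A (g j) j = 1) (hex : ∃ ℓ, g ℓ ≠ i ∧ A i ℓ = 1)
    (hj : g j = i) (h0 : A i j = 0) :
    smoothValue A p (structuredScheme A g) i j =
      unassignedOnes A g i / (assignedZeros A g i + unassignedOnes A g i) := by
  classical
  have hb : (structuredScheme A g).bundle i j =
      ({ℓ | g ℓ = i ↔ A i ℓ = 0} : Finset (Fin m)) := by
    ext ℓ
    rw [mem_structuredScheme, (structuredKey_eq_true_iff (j := j) hA hg hex).2 (by simp [hj, h0]),
      structuredKey_eq_true_iff hA hg hex]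
    simp
  rw [smoothValue_uniform hm hp, hb, card_eq_sum_ones, Nat.cast_sum, sum_filter, sum_filter]
  simp only [unassignedOnes, assignedZeros]
  rw [← sum_add_distrib]
  congr 1
  all_goals
    refine sum_congr rfl fun ℓ _ => ?_
    rcases hA i ℓ with h | h <;> by_cases hℓ : g ℓ = i <;> simp [h, hℓ]

theorem smoothValue_nonneg {p : Fin m → ℝ} (hm : 0 < m) (hp : ∀ j, p j = 1 / m)
    (hA : ∀ i j, A i j = 0 ∨ A i j = 1) (B : PartitionScheme n m) (i : Fin n) (j : Fin m) :
    0 ≤ smoothValue A p B i j := by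
  rw [smoothValue_uniform hm hp]
  exact div_nonneg (sum_nonneg fun ℓ _ => entry_nonneg hA i ℓ) (Nat.cast_nonneg _)

theorem rowValue_le_sum_smoothValue {p : Fin m → ℝ} (hm : 0 < m) (hp : ∀ j, p j = 1 / m)
    (hA : ∀ i j, A i j = 0 ∨ A i j = 1) (hg : ∀ j, (∃ i, A i j = 1) → A (g j) j = 1)
    (i : Fin n) :
    rowValue A g i ≤ ∑ j, if g j = i then smoothValue A p (structuredScheme A g) i j else 0 := by
  rw [rowValue, parallelSum, mul_div_assoc, assignedOnes]
  nth_rw 1 [assignedZeros]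
  rw [sum_mul, ← sum_add_distrib]
  refine sum_le_sum fun j _ => ?_
  by_cases hj : g j = i
  · simp only [hj, if_true]
    rcases hA i j with h | h
    · by_cases hex : ∃ ℓ, g ℓ ≠ i ∧ A i ℓ = 1
      · simp [smoothValue_structuredScheme_of_zero hm hp hA hg hex hj h, h]
      · have hu : unassignedOnes A g i = 0 := sum_eq_zero fun ℓ _ => by
          split_ifs with hℓ
          · rfl
          · exact (hA i ℓ).resolve_right fun h1 => hex ⟨ℓ, hℓ, h1⟩
        simpa [h, hu] using smoothValue_nonneg hm hp hA (structuredScheme A g) i j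
    · simp [smoothValue_uniform hm hp, structuredScheme_bundle_eq_singleton hj h, h]
  · simp [hj]

theorem le_partitionValue_structuredScheme {p : Fin m → ℝ} (hm : 0 < m)
    (hp : ∀ j, p j = 1 / m) (hA : ∀ i j, A i j = 0 ∨ A i j = 1)
    (hg : ∀ j, (∃ i, A i j = 1) → A (g j) j = 1) :
    1 / m * ∑ i, rowValue A g i ≤ partitionValue A p (structuredScheme A g) := by
  rw [partitionValue_uniform hp]
  gcongr
  calc ∑ i, rowValue A g i
      ≤ ∑ i, ∑ j, if g j = i then smoothValue A p (structuredScheme A g) i j else 0 :=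
        sum_le_sum fun i _ => rowValue_le_sum_smoothValue hm hp hA hg i
    _ = ∑ j, ∑ i, if g j = i then smoothValue A p (structuredScheme A g) i j else 0 := sum_comm
    _ ≤ _ := sum_le_sum fun j _ => by
        simpa using le_ciSup
          (f := fun i => smoothValue A p (structuredScheme A g) i j)
          (Set.finite_range _).bddAbove (g j)

end Construction

/-- For every uniform instance there is an optimal partition scheme B
satisfying properties P1–P4: P1: B fully covers A⁺; P2: in each row the non-covering
one-entries lie in a single common bundle; P3: each zero-column lies in a mixed bundle
in at most one row; P4: in each row, the zero-columns outside the mixed bundle form a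
single bundle consisting entirely of zero-columns. -/
theorem exists_optimal_structured_scheme {n m : ℕ} (hn : 0 < n) (hm : 0 < m)
    (A : Fin n → Fin m → ℝ) (hA : ∀ i j, A i j = 0 ∨ A i j = 1)
    (p : Fin m → ℝ) (hp : ∀ j, p j = 1 / m) :
    ∃ B : PartitionScheme n m,
      (∀ B' : PartitionScheme n m, partitionValue A p B' ≤ partitionValue A p B) ∧
      -- P1: B fully covers A⁺
      (∀ j : Fin m, (∃ i, A i j = 1) → ∃ i, A i j = 1 ∧ B.bundle i j = {j}) ∧
      -- P2: the one-entries of row i not forming column-covering bundles share a bundle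
      (∀ (i : Fin n) (j j' : Fin m), A i j = 1 → A i j' = 1 →
        B.bundle i j ≠ {j} → B.bundle i j' ≠ {j'} → B.bundle i j = B.bundle i j') ∧
      -- P3: a zero-column lies in a mixed bundle in at most one row
      (∀ j : Fin m, (∀ i, A i j = 0) → ∀ i i' : Fin n,
        MixedBundle A i (B.bundle i j) → MixedBundle A i' (B.bundle i' j) → i = i') ∧
      -- P4: in each row, zero-columns outside the mixed bundle share a single bundle…
      (∀ (i : Fin n) (j j' : Fin m), (∀ i', A i' j = 0) → (∀ i', A i' j' = 0) →
        ¬ MixedBundle A i (B.bundle i j) → ¬ MixedBundle A i (B.bundle i j') →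
        B.bundle i j = B.bundle i j') ∧
      -- …and that bundle consists entirely of zero-columns
      (∀ (i : Fin n) (j : Fin m), (∀ i', A i' j = 0) →
        ¬ MixedBundle A i (B.bundle i j) →
        ∀ j'' ∈ B.bundle i j, ∀ i', A i' j'' = 0) := by
  have : Nonempty (Fin n) := ⟨⟨0, hn⟩⟩
  obtain ⟨f, hf⟩ := Finite.exists_max fun f : Fin m → Fin n => ∑ i, rowValue A f i
  obtain ⟨g, hfg, hg⟩ := exists_covering_assignment hA f
  refine ⟨structuredScheme A g, fun B' => ?_, fun j hj => ?_, fun i j j' hj hj' hs hs' => ?_,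
    fun j hz i i' hi hi' => ?_, fun i j j' hz hz' hj hj' => ?_, fun i j hz hj j'' hj'' i' => ?_⟩
  · obtain ⟨f', hf'⟩ := exists_partitionValue_le hn hm hp hA B'
    refine (hf'.trans ?_).trans (le_partitionValue_structuredScheme hm hp hA hg)
    exact mul_le_mul_of_nonneg_left ((hf f').trans hfg) (by positivity)
  · exact ⟨g j, hg j hj, structuredScheme_bundle_eq_singleton rfl (hg j hj)⟩
  · apply structuredScheme_bundle_eq
    rw [structuredKey_of_unassigned_one
        (fun h => hs (structuredScheme_bundle_eq_singleton h hj)) hj,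
      structuredKey_of_unassigned_one
        (fun h => hs' (structuredScheme_bundle_eq_singleton h hj')) hj']
  · have aux : ∀ k, MixedBundle A k ((structuredScheme A g).bundle k j) → g j = k := by
      intro k hk
      rw [mixedBundle_structuredScheme_iff hz] at hk
      rcases structuredKey_of_zero_column (g := g) (i := k) hz with h | h
      · exact h.1
      · simp [h] at hk
    exact (aux i hi).symm.trans (aux i' hi')
  · rw [mixedBundle_structuredScheme_iff hz] at hj
    rw [mixedBundle_structuredScheme_iff hz'] at hj'
    apply structuredScheme_bundle_eq
    rw [(structuredKey_of_zero_column hz).resolve_left fun h => hj h.2.2,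
      (structuredKey_of_zero_column hz').resolve_left fun h => hj' h.2.2]
  · rw [mixedBundle_structuredScheme_iff hz] at hj
    rw [mem_structuredScheme,
      (structuredKey_of_zero_column hz).resolve_left fun h => hj h.2.2] at hj''
    exact (hA i' j'').resolve_right (structuredKey_eq_false hj'' i')
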